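/- Let n ≥ s ≥ 2 and let V ∈ ℝ^{n×s} have orthonormal columns, with V' ∈ ℝ^{n×(s−1)} its first s−1 columns and v ∈ ℝⁿ its last column. Let x₁, …, x_K ∈ ℝⁿ be snapshots, let ŷ_k ∈ ℝ^{s−1} for 1 ≤ k ≤ K, and set ẑ_k := (ŷ_k, vᵀx₁) ∈ ℝ^s. Then Σ_{k=1}^K ‖V ẑ_k − x_k‖₂² ≤ Σ_{k=1}^K ‖V' ŷ_k − x_k‖₂² + 3K (vᵀx₁)² + Σ_{k=1}^K (vᵀx_k)². (Worst-case bound on the increase of the snapshot reconstruction error incurred by the zero-padded expansion in one iteration of nested Operator Inference.) -/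

import Mathlib

open Matrix

/-- Appending the coefficient `a` of the last column of a matrix with orthonormal columns changes
the squared reconstruction error of `x` by `a ^ 2 - 2 * a * (vᵀ x)`. -/
theorem sum_sq_mulVec_snoc_sub {n d : ℕ} (V : Matrix (Fin n) (Fin (d + 1)) ℝ) (hV : Vᵀ * V = 1)
    (x : Fin n → ℝ) (y : Fin d → ℝ) (a : ℝ) :
    ∑ i, (V.mulVec (Fin.snoc y a) i - x i) ^ 2
      = (∑ i, ((∑ j, V i (Fin.castSucc j) * y j) - x i) ^ 2)
        + a ^ 2 - 2 * a * ∑ i, V i (Fin.last d) * x i := by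
  have hcol (j l) : ∑ i, V i j * V i l = (1 : Matrix (Fin (d + 1)) (Fin (d + 1)) ℝ) j l := by
    rw [← hV]; rfl
  have hunit : ∑ i, V i (Fin.last d) * V i (Fin.last d) = 1 := by simp [hcol]
  have horth : ∑ i, V i (Fin.last d) * ∑ j, V i (Fin.castSucc j) * y j = 0 := by
    simp_rw [Finset.mul_sum, ← mul_assoc]
    rw [Finset.sum_comm]
    simp_rw [← Finset.sum_mul, hcol]
    simp [(Fin.castSucc_ne_last _).symm]
  have hsnoc (i) : V.mulVec (Fin.snoc y a) i
      = (∑ j, V i (Fin.castSucc j) * y j) + V i (Fin.last d) * a := by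
    simp [Matrix.mulVec, dotProduct, Fin.sum_univ_castSucc]
  calc ∑ i, (V.mulVec (Fin.snoc y a) i - x i) ^ 2
      = ∑ i, (((∑ j, V i (Fin.castSucc j) * y j) - x i) ^ 2
          + a ^ 2 * (V i (Fin.last d) * V i (Fin.last d))
          + 2 * a * (V i (Fin.last d) * ∑ j, V i (Fin.castSucc j) * y j)
          - 2 * a * (V i (Fin.last d) * x i)) :=
        Finset.sum_congr rfl fun i _ => by rw [hsnoc]; ring
    _ = _ := by
        rw [Finset.sum_sub_distrib, Finset.sum_add_distrib, Finset.sum_add_distrib,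
          ← Finset.mul_sum, ← Finset.mul_sum, ← Finset.mul_sum, hunit, horth]
        ring

/-- Worst-case bound on the increase of the snapshot
reconstruction error incurred by the zero-padded expansion in one iteration of
nested Operator Inference: with `V ∈ ℝ^{n×(d+1)}` orthonormal, `V'` its first
`d` columns, `v` its last column, snapshots `x k` (so `x₁ = x ⟨0, hK⟩`), and
`ẑ_k = (ŷ_k, vᵀx₁)`,
`Σ ‖V ẑ_k − x_k‖² ≤ Σ ‖V' ŷ_k − x_k‖² + 3K (vᵀx₁)² + Σ (vᵀx_k)²`. -/
theorem stmt8 (n d K : ℕ) (hd : 1 ≤ d) (hn : d + 1 ≤ n) (hK : 1 ≤ K)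
    (V : Matrix (Fin n) (Fin (d + 1)) ℝ) (hV : Vᵀ * V = 1)
    (x : Fin K → Fin n → ℝ) (yh : Fin K → Fin d → ℝ) :
    ∑ k, ∑ i,
        (V.mulVec (Fin.snoc (yh k) (∑ i, V i (Fin.last d) * x ⟨0, hK⟩ i)) i
          - x k i) ^ 2
      ≤ (∑ k, ∑ i, ((∑ j, V i (Fin.castSucc j) * yh k j) - x k i) ^ 2)
        + 3 * (K : ℝ) * (∑ i, V i (Fin.last d) * x ⟨0, hK⟩ i) ^ 2
        + ∑ k, (∑ i, V i (Fin.last d) * x k i) ^ 2 := by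
  simp_rw [sum_sq_mulVec_snoc_sub V hV]
  set a := ∑ i, V i (Fin.last d) * x ⟨0, hK⟩ i
  have hconst : 3 * (K : ℝ) * a ^ 2 = ∑ _k : Fin K, 3 * a ^ 2 := by
    simp only [Finset.sum_const, Finset.card_univ, Fintype.card_fin, nsmul_eq_mul]
    ring
  rw [hconst, ← Finset.sum_add_distrib, ← Finset.sum_add_distrib]
  refine Finset.sum_le_sum fun k _ => ?_
  nlinarith [sq_nonneg (a + ∑ i, V i (Fin.last d) * x k i), sq_nonneg a]
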